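/- arXiv:2006.07799 — 2 statements merged into one kernel-verified Lean document; each statement's English description precedes it below -/
import Mathlib

section
/- (Vietoris) Let n ≥ 1 and let c_1 ≥ c_2 ≥ ⋯ ≥ c_n > 0 be real numbers such that (2k)·c_{2k} ≤ (2k−1)·c_{2k−1} for all k ≥ 1 with 2k ≤ n. Then Σ_{k=1}^{n} c_k · sin(kθ) > 0 for all θ with 0 < θ < π. -/
/-- The numbers `(1/2)_k / k!`. -/
noncomputable def vA : ℕ → ℝ
  | 0 => 1
  | k + 1 => vA k * ((2 * k + 1) / (2 * k + 2))

/-- The extremal Vietoris sequence. -/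
noncomputable def vB (k : ℕ) : ℝ := vA (k / 2)

lemma vA_pos (k : ℕ) : 0 < vA k := by
  induction k with
  | zero => simp [vA]
  | succ k ih => rw [vA]; positivity

lemma vB_pos (k : ℕ) : 0 < vB k := vA_pos _

lemma vB_even (k : ℕ) : vB (2 * k) = vA k := by simp [vB]

lemma vB_odd (k : ℕ) : vB (2 * k + 1) = vA k := by
  unfold vB; congr 1; omega

lemma vA_succ_le (k : ℕ) : vA (k + 1) ≤ vA k := by
  rw [vA]
  apply mul_le_of_le_one_right (vA_pos k).le
  rw [div_le_one (by positivity)]; linarith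

lemma vB_anti : Antitone vB := by
  have h : Antitone vA := antitone_nat_of_succ_le vA_succ_le
  intro a b hab
  exact h (Nat.div_le_div_right hab)

lemma vA_sq (k : ℕ) : vA k ^ 2 * (3 * k + 1) ≤ 1 := by
  induction k with
  | zero => simp [vA]
  | succ k ih =>
    rw [vA]
    refine le_trans ?_ ih
    have h0 := vA_pos k
    have : ((2 * (k:ℝ) + 1) / (2 * k + 2)) ^ 2 * (3 * (k + 1) + 1) ≤ 3 * k + 1 := by
      rw [div_pow, div_mul_eq_mul_div, div_le_iff₀ (by positivity)]
      have : (0:ℝ) ≤ k := by positivity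
      nlinarith
    push_cast
    rw [mul_pow, mul_assoc]
    exact mul_le_mul_of_nonneg_left this (by positivity)

lemma vB_sq (n : ℕ) : vB (n + 1) ^ 2 * (3 * n + 2) ≤ 2 := by
  have h := vA_sq ((n + 1) / 2)
  have h2 : (n : ℝ) ≤ 2 * ((n + 1) / 2 : ℕ) := by
    have : n ≤ 2 * ((n + 1) / 2) := by omega
    exact_mod_cast this
  unfold vB
  nlinarith [sq_nonneg (vA ((n + 1) / 2))]

lemma vA_choose (k : ℕ) : Ring.choose (-1 / 2 : ℂ) k * (-1) ^ k = (vA k : ℂ) := by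
  induction k with
  | zero => simp [vA]
  | succ k ih =>
    have h := Ring.choose_smul_choose (-1 / 2 : ℂ) (Nat.le_succ k)
    simp at h
    rw [vA]
    push_cast
    rw [← ih]
    have hk : (k : ℂ) + 1 ≠ 0 := by exact_mod_cast Nat.succ_ne_zero k
    have : Ring.choose (-1 / 2 : ℂ) (k + 1) = Ring.choose (-1 / 2 : ℂ) k * (-1 / 2 - k) / (k + 1) := by
      rw [eq_div_iff hk, ← h]; ring
    rw [this]
    have hk2 : (2 * (k : ℂ) + 2) ≠ 0 := by
      have : (2 * (k : ℂ) + 2) = 2 * (k + 1) := by ring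
      rw [this]; exact mul_ne_zero two_ne_zero hk
    field_simp
    ring

lemma vA_hasSum (z : ℂ) (hz : ‖z‖ < 1) :
    HasSum (fun k => (vA k : ℂ) * z ^ k) ((1 - z) ^ (-1 / 2 : ℂ)) := by
  have h := (Complex.one_add_cpow_hasFPowerSeriesOnBall_zero (a := -1 / 2)).hasSum (y := -z)
    (by simpa [← ENNReal.ofReal_one, Metric.eball_ofReal] using hz)
  have e : (fun k => (vA k : ℂ) * z ^ k) = fun k =>
      (binomialSeries ℂ (-1 / 2 : ℂ) k) fun _ => -z := by
    funext k
    rw [← vA_choose]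
    rw [binomialSeries_apply]
    simp [neg_pow z]
    ring
  rw [e, sub_eq_add_neg]
  simpa only [zero_add] using h

lemma vB_hasSum (z : ℂ) (hz : ‖z‖ < 1) :
    HasSum (fun k => (vB k : ℂ) * z ^ k) ((1 + z) * (1 - z ^ 2) ^ (-1 / 2 : ℂ)) := by
  have h := vA_hasSum (z ^ 2) (by
    rw [norm_pow]; exact pow_lt_one₀ (norm_nonneg _) hz two_ne_zero)
  rw [add_mul, one_mul]
  apply HasSum.even_add_odd
  · simpa [vB_even, pow_mul] using h
  · have e : (fun k => (vB (2 * k + 1) : ℂ) * z ^ (2 * k + 1)) =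
        fun k => z * ((vA k : ℂ) * (z ^ 2) ^ k) := by
      funext k
      rw [vB_odd]; ring
    rw [e]
    exact h.mul_left z

lemma vB_tail_fin (w : ℂ) (hw : ‖w‖ ≤ 1) (n N : ℕ) :
    ‖(1 - w) * ∑ k ∈ Finset.range (N + 1), (vB (n + k) : ℂ) * w ^ (n + k)
      + vB (n + N) * w ^ (n + N + 1)‖ ≤ 2 * vB n - vB (n + N) := by
  induction N with
  | zero =>
    simp only [zero_add, Finset.range_one, Finset.sum_singleton, add_zero]
    have : (1 - w) * ((vB n : ℂ) * w ^ n) + vB n * w ^ (n + 1) = vB n * w ^ n := by ring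
    rw [this, norm_mul, norm_pow, Complex.norm_real, Real.norm_of_nonneg (vB_pos n).le]
    have := mul_le_of_le_one_right (vB_pos n).le (pow_le_one₀ (norm_nonneg w) hw (n := n))
    linarith
  | succ N ih =>
    rw [Finset.sum_range_succ]
    have e : (1 - w) * (∑ k ∈ Finset.range (N + 1), (vB (n + k) : ℂ) * w ^ (n + k)
        + (vB (n + (N + 1)) : ℂ) * w ^ (n + (N + 1))) + vB (n + (N + 1)) * w ^ (n + (N + 1) + 1)
       = ((1 - w) * ∑ k ∈ Finset.range (N + 1), (vB (n + k) : ℂ) * w ^ (n + k)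
      + vB (n + N) * w ^ (n + N + 1)) - ((vB (n + N) - vB (n + (N + 1)) : ℝ) : ℂ) * w ^ (n + N + 1) := by
      push_cast; ring
    rw [e]
    refine (norm_sub_le _ _).trans ?_
    have hd : 0 ≤ vB (n + N) - vB (n + (N + 1)) := sub_nonneg.2 (vB_anti (by omega))
    rw [norm_mul, norm_pow, Complex.norm_real, Real.norm_of_nonneg hd]
    have := mul_le_of_le_one_right hd (pow_le_one₀ (norm_nonneg w) hw (n := n + N + 1))
    linarith

open Filter Topology in
lemma vB_tail (z : ℂ) (hz : ‖z‖ < 1) (n : ℕ) :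
    ‖1 - z‖ * ‖(1 + z) * (1 - z ^ 2) ^ (-1 / 2 : ℂ) - ∑ k ∈ Finset.range n, (vB k : ℂ) * z ^ k‖
      ≤ 2 * vB n := by
  have h := (hasSum_nat_add_iff' n).2 (vB_hasSum z hz)
  have h1 := (h.tendsto_sum_nat.const_mul (1 - z)).norm
  rw [norm_mul] at h1
  refine le_of_tendsto h1 ?_
  filter_upwards [eventually_ge_atTop 1] with N hN
  obtain ⟨M, rfl⟩ : ∃ M, N = M + 1 := ⟨N - 1, by omega⟩
  have h2 := vB_tail_fin z hz.le n M
  simp only [add_comm _ n]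
  have h3 : ‖(vB (n + M) : ℂ) * z ^ (n + M + 1)‖ ≤ vB (n + M) := by
    rw [norm_mul, norm_pow, Complex.norm_real, Real.norm_of_nonneg (vB_pos _).le]
    exact mul_le_of_le_one_right (vB_pos _).le (pow_le_one₀ (norm_nonneg _) hz.le)
  have h4 := norm_sub_le ((1 - z) * ∑ k ∈ Finset.range (M + 1), (vB (n + k) : ℂ) * z ^ (n + k)
      + vB (n + M) * z ^ (n + M + 1)) (vB (n + M) * z ^ (n + M + 1))
  rw [add_sub_cancel_right] at h4
  linarith

open Filter Topology in
lemma vB_tail_bd (w : ℂ) (hw : ‖w‖ = 1) (hs : 1 - w ^ 2 ∈ Complex.slitPlane) (n : ℕ) :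
    ‖1 - w‖ * ‖(1 + w) * (1 - w ^ 2) ^ (-1 / 2 : ℂ) - ∑ k ∈ Finset.range n, (vB k : ℂ) * w ^ k‖
      ≤ 2 * vB n := by
  have hc : ContinuousAt (fun z : ℂ => ‖1 - z‖ * ‖(1 + z) * (1 - z ^ 2) ^ (-1 / 2 : ℂ)
      - ∑ k ∈ Finset.range n, (vB k : ℂ) * z ^ k‖) w := by
    have : ContinuousAt (fun z : ℂ => (1 - z ^ 2) ^ (-1 / 2 : ℂ)) w :=
      ContinuousAt.cpow (by fun_prop) (by fun_prop) hs
    fun_prop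
  have hr : Tendsto (fun r : ℝ => (r : ℂ) * w) (𝓝[<] 1) (𝓝 w) := by
    have : Tendsto (fun r : ℝ => (r : ℂ) * w) (𝓝 1) (𝓝 (((1 : ℝ) : ℂ) * w)) := by
      apply Continuous.tendsto; fun_prop
    simp only [Complex.ofReal_one, one_mul] at this
    exact this.mono_left nhdsWithin_le_nhds
  refine le_of_tendsto (hc.tendsto.comp hr) ?_
  have : ∀ᶠ r : ℝ in 𝓝[<] 1, r ∈ Set.Ioo (0 : ℝ) 1 := Ioo_mem_nhdsLT one_pos
  filter_upwards [this] with r hr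
  apply vB_tail
  rw [norm_mul, hw, Complex.norm_real, Real.norm_of_nonneg hr.1.le, mul_one]
  exact hr.2

lemma v_middle (n : ℕ) (θ : ℝ) (h0 : 0 < θ) (h1 : θ < Real.pi)
    (hs : 4 * vB (n + 1) ^ 2 < Real.sin θ) :
    0 < ∑ k ∈ Finset.Icc 1 n, vB k * Real.sin (k * θ) := by
  have hsin : 0 < Real.sin θ := Real.sin_pos_of_pos_of_lt_pi h0 h1
  have hs2 : 0 < Real.sin (θ / 2) := Real.sin_pos_of_pos_of_lt_pi (by linarith) (by linarith)
  have hc2 : 0 < Real.cos (θ / 2) := Real.cos_pos_of_mem_Ioo ⟨by linarith, by linarith⟩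
  have hdouble : Real.sin θ = 2 * Real.sin (θ / 2) * Real.cos (θ / 2) := by
    rw [← Real.sin_two_mul]; congr 1; ring
  set w : ℂ := Complex.exp (θ * Complex.I) with hw
  set v : ℂ := Complex.exp ((θ / 2 : ℝ) * Complex.I) with hv
  have hvw : w = v * v := by
    rw [hw, hv, ← Complex.exp_add]; congr 1; push_cast; ring
  have hv' : v = (Real.cos (θ / 2) : ℂ) + Real.sin (θ / 2) * Complex.I := by
    rw [hv, Complex.exp_mul_I, Complex.ofReal_cos, Complex.ofReal_sin]
  have hcs : (Real.cos (θ / 2) : ℂ) ^ 2 + (Real.sin (θ / 2) : ℂ) ^ 2 = 1 := by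
    exact_mod_cast Real.cos_sq_add_sin_sq (θ / 2)
  have hI : Complex.I ^ 2 = -1 := Complex.I_sq
  have e1 : 1 + w = (2 * Real.cos (θ / 2) : ℝ) * v := by
    rw [hvw, hv']; simp only [Complex.ofReal_mul, Complex.ofReal_ofNat]
    linear_combination -hcs + (Real.sin (θ / 2) : ℂ) ^ 2 * hI
  have e2 : 1 - w = (2 * Real.sin (θ / 2) : ℝ) * (-Complex.I * v) := by
    rw [hvw, hv']; simp only [Complex.ofReal_mul, Complex.ofReal_ofNat]
    linear_combination -hcs + (Real.sin (θ / 2) : ℂ) ^ 2 * hI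
  have nv : ‖v‖ = 1 := Complex.norm_exp_ofReal_mul_I _
  have nw : ‖w‖ = 1 := Complex.norm_exp_ofReal_mul_I _
  have n1 : ‖1 - w‖ = 2 * Real.sin (θ / 2) := by
    rw [e2, norm_mul, Complex.norm_real, Real.norm_of_nonneg (by positivity)]
    simp [nv]
  have e3 : 1 - w ^ 2 = (2 * Real.sin θ : ℝ) * Complex.exp ((θ - Real.pi / 2 : ℝ) * Complex.I) := by
    have : Complex.exp ((θ - Real.pi / 2 : ℝ) * Complex.I) = -Complex.I * w := by
      have : ((θ - Real.pi / 2 : ℝ) : ℂ) * Complex.I = -(Real.pi / 2 * Complex.I) + θ * Complex.I := by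
        push_cast; ring
      rw [this, Complex.exp_add, Complex.exp_neg, Complex.exp_pi_div_two_mul_I, Complex.inv_I]
    rw [this, hdouble, show 1 - w ^ 2 = (1 + w) * (1 - w) by ring, e1, e2, hvw]
    push_cast; ring
  have hρ := Real.exp_pos (-(1 / 2) * Real.log (2 * Real.sin θ))
  set ρ : ℝ := Real.exp (-(1 / 2) * Real.log (2 * Real.sin θ)) with hρd
  have hρ2 : ρ ^ 2 * (2 * Real.sin θ) = 1 := by
    have h2 : (2 * Real.sin θ) = Real.exp (Real.log (2 * Real.sin θ)) :=
      (Real.exp_log (by positivity)).symm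
    rw [hρd]
    conv_lhs => rw [h2]
    rw [Real.log_exp, sq, ← Real.exp_add, ← Real.exp_add]
    convert Real.exp_zero using 2; ring
  have hre : 0 < (1 - w ^ 2).re := by
    rw [e3, Complex.re_ofReal_mul, Complex.exp_ofReal_mul_I_re, Real.cos_sub_pi_div_two]
    positivity
  have hslit : 1 - w ^ 2 ∈ Complex.slitPlane := Or.inl hre
  have e4 : (1 - w ^ 2) ^ (-1 / 2 : ℂ) = (ρ : ℂ) * Complex.exp ((Real.pi / 4 - θ / 2 : ℝ) * Complex.I) := by
    rw [Complex.cpow_def_of_ne_zero (Complex.slitPlane_ne_zero hslit), e3,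
      Complex.log_ofReal_mul (by positivity) (Complex.exp_ne_zero _), Complex.log_exp]
    · rw [hρd, Complex.ofReal_exp, ← Complex.exp_add]
      congr 1; push_cast; ring
    · simp; linarith
    · simp; linarith
  have e5 : ((1 + w) * (1 - w ^ 2) ^ (-1 / 2 : ℂ)).im = 2 * Real.cos (θ / 2) * ρ * (√2 / 2) := by
    have : (1 + w) * (1 - w ^ 2) ^ (-1 / 2 : ℂ) =
        ((2 * Real.cos (θ / 2) * ρ : ℝ) : ℂ) * Complex.exp ((Real.pi / 4 : ℝ) * Complex.I) := by
      have : Complex.exp ((Real.pi / 4 : ℝ) * Complex.I) =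
          v * Complex.exp ((Real.pi / 4 - θ / 2 : ℝ) * Complex.I) := by
        rw [hv, ← Complex.exp_add]; congr 1; push_cast; ring
      rw [this, e1, e4]; push_cast; ring
    rw [this, Complex.im_ofReal_mul, Complex.exp_ofReal_mul_I_im, Real.sin_pi_div_four]
  have e6 : (∑ k ∈ Finset.range (n + 1), (vB k : ℂ) * w ^ k).im =
      ∑ k ∈ Finset.Icc 1 n, vB k * Real.sin (k * θ) := by
    have hk : ∀ k : ℕ, ((vB k : ℂ) * w ^ k).im = vB k * Real.sin (k * θ) := by
      intro k
      rw [Complex.im_ofReal_mul, hw, ← Complex.exp_nat_mul, ← Complex.exp_ofReal_mul_I_im]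
      congr 3; push_cast; ring
    rw [Complex.im_sum, Finset.sum_congr rfl (fun k _ => hk k), Finset.range_eq_Ico,
      Finset.sum_eq_sum_Ico_succ_bot (by omega)]
    simp
    rfl
  have hb := vB_tail_bd w nw hslit (n + 1)
  by_contra hneg
  push Not at hneg
  rw [← e6] at hneg
  have him := (Complex.abs_im_le_norm ((1 + w) * (1 - w ^ 2) ^ (-1 / 2 : ℂ) -
    ∑ k ∈ Finset.range (n + 1), (vB k : ℂ) * w ^ k))
  have him2 := (le_abs_self _).trans him
  rw [Complex.sub_im, e5] at him2
  rw [n1] at hb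
  have h6 : 2 * Real.sin (θ / 2) * (2 * Real.cos (θ / 2) * ρ * (√2 / 2)) ≤ 2 * vB (n + 1) :=
    (mul_le_mul_of_nonneg_left (by linarith) (by positivity)).trans hb
  have h7 : Real.sin θ * ρ * √2 ≤ 2 * vB (n + 1) := by rw [hdouble]; linarith
  have h8 := pow_le_pow_left₀ (by positivity) h7 2
  have h9 : (Real.sin θ * ρ * √2) ^ 2 = Real.sin θ := by
    rw [mul_pow, Real.sq_sqrt (by norm_num)]
    linear_combination Real.sin θ * hρ2
  rw [h9] at h8
  nlinarith

lemma v_low (n : ℕ) (hn : 1 ≤ n) (θ : ℝ) (h0 : 0 < θ) (h1 : θ < Real.pi) (h : n * θ ≤ Real.pi) :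
    0 < ∑ k ∈ Finset.Icc 1 n, vB k * Real.sin (k * θ) := by
  apply Finset.sum_pos'
  · intro k hk
    rw [Finset.mem_Icc] at hk
    have : (k : ℝ) ≤ n := by exact_mod_cast hk.2
    exact mul_nonneg (vB_pos k).le (Real.sin_nonneg_of_nonneg_of_le_pi (by positivity)
      ((mul_le_mul_of_nonneg_right this h0.le).trans h))
  · refine ⟨1, by simp [hn], ?_⟩
    simpa using mul_pos (vB_pos 1) (Real.sin_pos_of_pos_of_lt_pi h0 h1)

lemma v_pair (m : ℕ) (φ : ℝ) (h0 : 0 < φ) (h : (2 * m + 2) * φ ≤ Real.pi) :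
    0 < vB (2 * m + 1) * Real.sin ((2 * m + 1) * φ) - vB (2 * m + 2) * Real.sin ((2 * m + 2) * φ) := by
  have e : vB (2 * m + 2) = vA (m + 1) := vB_even (m + 1)
  rw [vB_odd, e, vA]
  have hm : (0 : ℝ) ≤ m := by positivity
  have hy : (0 : ℝ) ≠ (2 * m + 2) * φ := by positivity
  have hc := strictConcaveOn_sin_Icc.2 ⟨le_rfl, Real.pi_pos.le⟩ ⟨by positivity, h⟩ hy
    (show (0 : ℝ) < 1 / (2 * m + 2) by positivity)
    (show (0 : ℝ) < (2 * m + 1) / (2 * m + 2) by positivity)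
    (by field_simp; ring)
  have e2 : (1 / (2 * (m : ℝ) + 2)) • (0 : ℝ) + ((2 * (m : ℝ) + 1) / (2 * m + 2)) • ((2 * m + 2) * φ)
      = (2 * m + 1) * φ := by
    simp only [smul_eq_mul]; field_simp; ring
  rw [e2] at hc
  simp only [smul_eq_mul, Real.sin_zero, mul_zero, zero_add] at hc
  have := mul_pos (vA_pos m) (sub_pos.2 hc)
  linarith

lemma v_high_even (m : ℕ) (φ : ℝ) (h0 : 0 < φ) (h : (2 * m) * φ ≤ Real.pi) :
    0 ≤ ∑ k ∈ Finset.Icc 1 (2 * m), vB k * Real.sin (k * (Real.pi - φ)) ∧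
    (1 ≤ m → 0 < ∑ k ∈ Finset.Icc 1 (2 * m), vB k * Real.sin (k * (Real.pi - φ))) := by
  induction m with
  | zero => simp
  | succ m ih =>
    push_cast at h
    have hp := v_pair m φ h0 (by linarith)
    have hi := (ih (by linarith)).1
    rw [show 2 * (m + 1) = 2 * m + 1 + 1 by ring, Finset.sum_Icc_succ_top (by omega),
      Finset.sum_Icc_succ_top (by omega)]
    have s1 : Real.sin (((2 * m + 1 : ℕ) : ℝ) * (Real.pi - φ)) = Real.sin ((2 * m + 1) * φ) := by
      have : ((2 * m + 1 : ℕ) : ℝ) * (Real.pi - φ) = Real.pi - (2 * m + 1) * φ + m * (2 * Real.pi) := by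
        push_cast; ring
      rw [this, Real.sin_add_nat_mul_two_pi, Real.sin_pi_sub]
    have s2 : Real.sin (((2 * m + 1 + 1 : ℕ) : ℝ) * (Real.pi - φ)) = - Real.sin ((2 * m + 2) * φ) := by
      have : ((2 * m + 1 + 1 : ℕ) : ℝ) * (Real.pi - φ) = - ((2 * m + 2) * φ) + (m + 1 : ℕ) * (2 * Real.pi) := by
        push_cast; ring
      rw [this, Real.sin_add_nat_mul_two_pi, Real.sin_neg]
    rw [s1, s2]
    constructor
    · linarith
    · intro _; linarith

lemma v_high (n : ℕ) (hn : 1 ≤ n) (φ : ℝ) (h0 : 0 < φ) (h1 : φ < Real.pi) (h : n * φ ≤ Real.pi) :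
    0 < ∑ k ∈ Finset.Icc 1 n, vB k * Real.sin (k * (Real.pi - φ)) := by
  rcases Nat.even_or_odd' n with ⟨m, rfl | rfl⟩
  · push_cast at h
    exact (v_high_even m φ h0 h).2 (by omega)
  · push_cast at h
    have hm := v_high_even m φ h0 (by linarith)
    rw [Finset.sum_Icc_succ_top (by omega)]
    have s1 : Real.sin (((2 * m + 1 : ℕ) : ℝ) * (Real.pi - φ)) = Real.sin ((2 * m + 1) * φ) := by
      have : ((2 * m + 1 : ℕ) : ℝ) * (Real.pi - φ) = Real.pi - (2 * m + 1) * φ + m * (2 * Real.pi) := by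
        push_cast; ring
      rw [this, Real.sin_add_nat_mul_two_pi, Real.sin_pi_sub]
    rw [s1]
    rcases Nat.eq_zero_or_pos m with rfl | hmp
    · simpa using mul_pos (vB_pos 1) (Real.sin_pos_of_pos_of_lt_pi h0 h1)
    · have := hm.2 hmp
      have := mul_nonneg (vB_pos (2 * m + 1)).le
        (Real.sin_nonneg_of_nonneg_of_le_pi (x := (2 * m + 1) * φ) (by positivity) h)
      linarith

lemma v_sin_bound (n : ℕ) (hn : 3 ≤ n) : 8 / (3 * n + 2) < Real.sin (Real.pi / n) := by
  have hn' : (3 : ℝ) ≤ n := by exact_mod_cast hn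
  have hp := Real.pi_gt_d2
  have hp2 := Real.pi_lt_d2
  have hx := Real.sin_gt_sub_cube (x := Real.pi / n) (by positivity)
  refine lt_of_le_of_lt ?_ hx
  have e : Real.pi / n - (Real.pi / n) ^ 3 / 6 = Real.pi * (6 * n ^ 2 - Real.pi ^ 2) / (6 * n ^ 3) := by
    field_simp
  rw [e, div_le_div_iff₀ (by positivity) (by positivity)]
  have h1 : 3.14 * (6 * (n : ℝ) ^ 2 - 9.9225) ≤ Real.pi * (6 * n ^ 2 - Real.pi ^ 2) := by
    apply mul_le_mul <;> nlinarith
  have h2 := mul_le_mul_of_nonneg_right h1 (show (0 : ℝ) ≤ 3 * n + 2 by positivity)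
  refine le_trans ?_ h2
  nlinarith [mul_nonneg (sub_nonneg.2 hn') (sub_nonneg.2 hn'), mul_nonneg (mul_nonneg (sub_nonneg.2 hn') (sub_nonneg.2 hn')) (sub_nonneg.2 hn')]

lemma v_main (n : ℕ) (hn : 1 ≤ n) (θ : ℝ) (h0 : 0 < θ) (h1 : θ < Real.pi) :
    0 < ∑ k ∈ Finset.Icc 1 n, vB k * Real.sin (k * θ) := by
  have hnp : (0 : ℝ) < n := by exact_mod_cast hn
  by_cases hl : n * θ ≤ Real.pi
  · exact v_low n hn θ h0 h1 hl
  by_cases hh : n * (Real.pi - θ) ≤ Real.pi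
  · simpa using v_high n hn (Real.pi - θ) (by linarith) (by linarith) hh
  push Not at hl hh
  have hn3 : 3 ≤ n := by
    by_contra hc
    have : (n : ℝ) ≤ 2 := by exact_mod_cast (by omega : n ≤ 2)
    nlinarith
  apply v_middle n θ h0 h1
  have hb := v_sin_bound n hn3
  have hl' : Real.pi / n < θ := by rw [div_lt_iff₀ hnp]; linarith
  have hh' : Real.pi / n < Real.pi - θ := by rw [div_lt_iff₀ hnp]; linarith
  have hpos : 0 < Real.pi / n := by positivity
  have hs : Real.sin (Real.pi / n) ≤ Real.sin θ := by
    rcases le_total θ (Real.pi / 2) with h | h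
    · exact Real.sin_le_sin_of_le_of_le_pi_div_two (by linarith) h hl'.le
    · rw [← Real.sin_pi_sub θ]
      exact Real.sin_le_sin_of_le_of_le_pi_div_two (by linarith) (by linarith) hh'.le
  have hq := vB_sq n
  have : 4 * vB (n + 1) ^ 2 ≤ 8 / (3 * n + 2) := by
    rw [le_div_iff₀ (by positivity)]; linarith
  linarith

/-- Summation by parts. -/
lemma v_abel (n : ℕ) (hn : 1 ≤ n) (d x : ℕ → ℝ) (hlast : 0 < d n)
    (hd : ∀ k, 1 ≤ k → k + 1 ≤ n → d (k + 1) ≤ d k)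
    (hx : ∀ k, 1 ≤ k → 0 < ∑ j ∈ Finset.Icc 1 k, x j) :
    0 < ∑ k ∈ Finset.Icc 1 n, d k * x k := by
  have key : ∀ k, 1 ≤ k → k ≤ n →
      d k * ∑ j ∈ Finset.Icc 1 k, x j ≤ ∑ j ∈ Finset.Icc 1 k, d j * x j := by
    intro k hk
    induction k, hk using Nat.le_induction with
    | base => intro _; simp
    | succ k hk ih =>
      intro hkn
      rw [Finset.sum_Icc_succ_top (by omega), Finset.sum_Icc_succ_top (by omega)]
      have := ih (by omega)
      have := mul_le_mul_of_nonneg_right (hd k hk hkn) (hx k hk).le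
      linarith
  exact lt_of_lt_of_le (mul_pos hlast (hx n hn)) (key n hn le_rfl)

/-- **Vietoris' theorem on positive sine sums.**
If `c_1 ≥ c_2 ≥ ⋯ ≥ c_n > 0` and `(2k)·c_{2k} ≤ (2k−1)·c_{2k−1}` whenever
`1 ≤ k` and `2k ≤ n`, then `Σ_{k=1}^{n} c_k sin(kθ) > 0` for all `0 < θ < π`. -/
theorem vietoris_sine_sum_pos (n : ℕ) (hn : 1 ≤ n) (c : ℕ → ℝ)
    (hlast : 0 < c n)
    (hdec : ∀ k, 1 ≤ k → k + 1 ≤ n → c (k + 1) ≤ c k)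
    (heven : ∀ k, 1 ≤ k → 2 * k ≤ n →
      ((2 * k : ℕ) : ℝ) * c (2 * k) ≤ ((2 * k - 1 : ℕ) : ℝ) * c (2 * k - 1)) :
    ∀ θ : ℝ, 0 < θ → θ < Real.pi →
      0 < ∑ k ∈ Finset.Icc 1 n, c k * Real.sin (k * θ) := by
  intro θ h0 h1
  have hmono : ∀ k, 1 ≤ k → k + 1 ≤ n → c (k + 1) / vB (k + 1) ≤ c k / vB k := by
    intro k hk hkn
    rw [div_le_div_iff₀ (vB_pos _) (vB_pos _)]
    rcases Nat.even_or_odd' k with ⟨m, rfl | rfl⟩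
    · rw [vB_even, vB_odd]
      exact mul_le_mul_of_nonneg_right (hdec _ hk hkn) (vA_pos m).le
    · have h := heven (m + 1) (by omega) (by omega)
      rw [show 2 * (m + 1) - 1 = 2 * m + 1 by omega, show 2 * (m + 1) = 2 * m + 1 + 1 by ring] at h
      push_cast at h
      have e : vB (2 * m + 1 + 1) = vA (m + 1) := vB_even (m + 1)
      rw [vB_odd, e, vA]
      have hA := vA_pos m
      have h2 : c (2 * m + 1 + 1) ≤ c (2 * m + 1) * ((2 * m + 1) / (2 * m + 2)) := by
        rw [mul_div_assoc', le_div_iff₀ (by positivity)]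
        linarith
      have := mul_le_mul_of_nonneg_right h2 hA.le
      linarith
  have h := v_abel n hn (fun k => c k / vB k) (fun k => vB k * Real.sin (k * θ))
    (div_pos hlast (vB_pos n)) hmono (fun k hk => v_main k hk θ h0 h1)
  refine lt_of_lt_of_eq h (Finset.sum_congr rfl fun k _ => ?_)
  have := (vB_pos k).ne'
  field_simp
end

section
/- Let l, r ≥ 0 be integers with r + 1 ≤ l ≤ r + 2, and let λ₀ be as in the context; write x₀(θ) = Re λ₀(e^{iθ}) and y₀(θ) = Im λ₀(e^{iθ}). Then there exist constants C₁ > 0, C > 0 and δ > 0, with C₁ depending only on l and r, such that for all θ with 0 < |θ| < δ, | x₀(θ) + C₁ · y₀(θ)^{2l} | ≤ C · |y₀(θ)|^{2l+1}. That is, x₀ = -C₁·y₀^{2l} + O(y₀^{2l+1}) as θ → 0. -/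
/-- Optimal finite-difference coefficients for the first derivative on the
stencil `{-l, …, r}`. -/
noncomputable def aCoef (l r : ℕ) (k : ℤ) : ℝ :=
  if k = 0 then
    -∑ ν ∈ (Finset.Icc (-(l : ℤ)) (r : ℤ)).erase 0, (1 : ℝ) / (ν : ℝ)
  else
    -((-1 : ℝ) ^ k / (k : ℝ)) *
      ((Nat.factorial l * Nat.factorial r : ℕ) : ℝ) /
      ((Nat.factorial ((l : ℤ) + k).toNat * Nat.factorial ((r : ℤ) - k).toNat : ℕ) : ℝ)

/-- The symbol `λ₀(s) = -Σ_{k=-l}^{r} a_k s^k` of the advection discretization. -/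
noncomputable def lam0 (l r : ℕ) (s : ℂ) : ℂ :=
  -∑ k ∈ Finset.Icc (-(l : ℤ)) (r : ℤ), (aCoef l r k : ℂ) * s ^ k

noncomputable def wC (l n j : ℕ) : ℝ :=
  (-1) ^ (j + l) * (n.choose j : ℝ) / (n.choose l : ℝ) / ((j : ℝ) - l)

lemma sum_Icc_reindex {M : Type*} [AddCommMonoid M] (l r : ℕ) (F : ℤ → M) :
    ∑ k ∈ Finset.Icc (-(l : ℤ)) (r : ℤ), F k =
      ∑ j ∈ Finset.range (l + r + 1), F ((j : ℤ) - l) := by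
  symm
  refine Finset.sum_bij (fun j _ => (j : ℤ) - l) ?_ ?_ ?_ ?_
  · intro j hj
    simp only [Finset.mem_range, Finset.mem_Icc] at *
    omega
  · intro a _ b _ h
    omega
  · intro b hb
    simp only [Finset.mem_Icc] at hb
    refine ⟨(b + l).toNat, ?_, ?_⟩
    · simp only [Finset.mem_range]; omega
    · omega
  · intros; rfl

lemma aCoef_eq (l r j : ℕ) (hj : j ≤ l + r) (hjl : j ≠ l) :
    aCoef l r ((j : ℤ) - l) = - wC l (l + r) j := by
  have h0 : (j : ℤ) - l ≠ 0 := by omega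
  have e1 : ((l : ℤ) + ((j : ℤ) - l)).toNat = j := by omega
  have e2 : ((r : ℤ) - ((j : ℤ) - l)).toNat = l + r - j := by omega
  unfold aCoef wC
  rw [if_neg h0, e1, e2, Nat.cast_choose ℝ hj, Nat.cast_choose ℝ (Nat.le_add_right l r)]
  have e3 : l + r - l = r := by omega
  rw [e3]
  have hs : (-1 : ℝ) ^ ((j : ℤ) - l) = (-1) ^ (j + l) := by
    rw [zpow_sub₀ (by norm_num), zpow_natCast, zpow_natCast, pow_add, div_eq_mul_inv, ← inv_pow]
    norm_num
  rw [hs]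
  have h3 : ((j : ℝ) - l) ≠ 0 := by
    rw [sub_ne_zero]; exact_mod_cast hjl
  push_cast
  have := Nat.factorial_ne_zero
  have f1 : (Nat.factorial l : ℝ) ≠ 0 := by exact_mod_cast this l
  have f2 : (Nat.factorial r : ℝ) ≠ 0 := by exact_mod_cast this r
  have f3 : (Nat.factorial j : ℝ) ≠ 0 := by exact_mod_cast this j
  have f4 : (Nat.factorial (l + r) : ℝ) ≠ 0 := by exact_mod_cast this (l + r)
  have f5 : (Nat.factorial (l + r - j) : ℝ) ≠ 0 := by exact_mod_cast this (l + r - j)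
  field_simp

lemma wC_self (l n : ℕ) : wC l n l = 0 := by simp [wC]

noncomputable def hC (l n : ℕ) : ℝ := ∑ j ∈ Finset.range (n + 1), 1 / ((j : ℝ) - l)

lemma aCoef_zero (l r : ℕ) : aCoef l r 0 = - hC l (l + r) := by
  unfold aCoef hC
  rw [if_pos rfl, Finset.sum_erase _ (by simp), sum_Icc_reindex]
  simp

lemma lam0_eq (l r : ℕ) (s : ℂ) : lam0 l r s =
    hC l (l + r) + ∑ j ∈ Finset.range (l + r + 1), (wC l (l + r) j : ℂ) * s ^ ((j : ℤ) - l) := by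
  unfold lam0
  rw [sum_Icc_reindex]
  have hl : l ∈ Finset.range (l + r + 1) := by simp
  rw [← Finset.add_sum_erase _ _ hl, ← Finset.add_sum_erase _ (fun j : ℕ => (wC l (l + r) j : ℂ) * s ^ ((j : ℤ) - l)) hl]
  simp only [sub_self, aCoef_zero, wC_self]
  rw [neg_add]
  rw [← Finset.sum_neg_distrib]
  simp only [zpow_zero, Complex.ofReal_neg, Complex.ofReal_zero]
  have : ∑ x ∈ (Finset.range (l + r + 1)).erase l, -(((aCoef l r ((x : ℤ) - l) : ℝ) : ℂ) * s ^ ((x : ℤ) - l))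
    = ∑ x ∈ (Finset.range (l + r + 1)).erase l, ((wC l (l + r) x : ℂ) * s ^ ((x : ℤ) - l)) := by
    refine Finset.sum_congr rfl fun x hx => ?_
    simp only [Finset.mem_erase, Finset.mem_range] at hx
    rw [aCoef_eq l r x (by omega) hx.1]
    push_cast; ring
  rw [this]; ring

lemma base_sum (l : ℕ) : ∑ j ∈ Finset.range (2 * l + 1), wC l (2 * l) j + hC l (2 * l) = 0 := by
  have key : ∀ f : ℕ → ℝ, (∀ j, j ≤ 2 * l → f (2 * l - j) = - f j) →
      ∑ j ∈ Finset.range (2 * l + 1), f j = 0 := by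
    intro f hf
    have h := Finset.sum_range_reflect f (2 * l + 1)
    have h' : ∑ j ∈ Finset.range (2 * l + 1), f (2 * l + 1 - 1 - j) =
        - ∑ j ∈ Finset.range (2 * l + 1), f j := by
      rw [← Finset.sum_neg_distrib]
      refine Finset.sum_congr rfl fun x hx => ?_
      simp only [Finset.mem_range] at hx
      exact hf x (by omega)
    linarith
  have c : ∀ j, j ≤ 2 * l → (((2 * l - j : ℕ) : ℝ) - l) = -((j : ℝ) - l) := by
    intro j hj; rw [Nat.cast_sub hj]; push_cast; ring
  rw [key, hC, key, add_zero]
  · intro j hj; rw [c j hj, div_neg]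
  · intro j hj
    unfold wC
    rw [c j hj, div_neg, Nat.choose_symm hj]
    have : (-1 : ℝ) ^ (2 * l - j + l) = (-1) ^ (j + l) := by
      apply neg_one_pow_congr
      grind
    rw [this]

lemma step_sum (l n : ℕ) (hln : l ≤ n) :
    ∑ j ∈ Finset.range (n + 2), wC (l + 1) (n + 1) j + hC (l + 1) (n + 1) =
    ∑ j ∈ Finset.range (n + 1), wC l n j + hC l n := by
  have hh : hC (l + 1) (n + 1) = hC l n - 1 / ((l : ℝ) + 1) := by
    unfold hC
    rw [Finset.sum_range_succ']
    push_cast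
    have : ((0 : ℝ) - (l + 1)) = -((l : ℝ) + 1) := by ring
    rw [this, div_neg, ← sub_eq_add_neg]
    congr 1
    refine Finset.sum_congr rfl fun x _ => ?_
    congr 1; ring
  have hl1 : (l : ℝ) + 1 ≠ 0 := by positivity
  have hN : ((n + 1).choose (l + 1) : ℝ) ≠ 0 := by
    exact_mod_cast (Nat.choose_pos (by omega)).ne'
  have hN' : (n.choose l : ℝ) ≠ 0 := by
    exact_mod_cast (Nat.choose_pos (by omega)).ne'
  have alt : ∑ i ∈ Finset.range (n + 2), (-1 : ℝ) ^ i * ((n + 1).choose i : ℝ) = 0 := by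
    have := Int.alternating_sum_range_choose_of_ne (n := n + 1) (by omega)
    exact_mod_cast this
  have hw : ∑ j ∈ Finset.range (n + 2), wC (l + 1) (n + 1) j =
      ∑ j ∈ Finset.range (n + 1), wC l n j + 1 / ((l : ℝ) + 1) := by
    have pt : ∀ j ∈ Finset.range (n + 1), wC (l + 1) (n + 1) (j + 1) = wC l n j
        - (-1) ^ (l + 1) / ((n + 1).choose (l + 1) : ℝ) / ((l : ℝ) + 1) *
          ((-1 : ℝ) ^ (j + 1) * ((n + 1).choose (j + 1) : ℝ))
        + if j = l then 1 / ((l : ℝ) + 1) else 0 := by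
      intro j _
      have q : ∀ i : ℕ, ((n + 1).choose (i + 1) : ℝ) = (n + 1) * (n.choose i : ℝ) / (i + 1) := by
        intro i
        have hi : (i : ℝ) + 1 ≠ 0 := by positivity
        rw [eq_div_iff hi]
        exact_mod_cast (Nat.add_one_mul_choose_eq n i).symm
      by_cases hjl : j = l
      · subst hjl
        rw [wC_self, wC_self, if_pos rfl]
        have : (-1 : ℝ) ^ (j + 1) * (-1 : ℝ) ^ (j + 1) = 1 := by
          rw [← mul_pow]; norm_num
        field_simp
        linear_combination this
      · have h3 : ((j : ℝ) - l) ≠ 0 := by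
          rw [sub_ne_zero]; exact_mod_cast hjl
        have h4 : ((j : ℝ) + 1 - (l + 1)) ≠ 0 := by
          intro h; apply h3; linarith
        have hj1 : (j : ℝ) + 1 ≠ 0 := by positivity
        have hn1 : (n : ℝ) + 1 ≠ 0 := by positivity
        rw [if_neg hjl]
        unfold wC
        rw [q, q]
        push_cast
        have e : (j : ℝ) + 1 - (l + 1) = j - l := by ring
        rw [e]
        field_simp
        ring
    have z : wC (l + 1) (n + 1) 0 = - ((-1) ^ (l + 1) / ((n + 1).choose (l + 1) : ℝ) / ((l : ℝ) + 1)) * ((-1 : ℝ) ^ 0 * ((n + 1).choose 0 : ℝ)) := by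
      unfold wC
      push_cast
      have : ((0 : ℝ) - (l + 1)) = -((l : ℝ) + 1) := by ring
      rw [this, div_neg]
      simp
    rw [Finset.sum_range_succ'] at alt ⊢
    rw [Finset.sum_congr rfl pt, Finset.sum_add_distrib, Finset.sum_sub_distrib, ← Finset.mul_sum,
      Finset.sum_ite_eq', if_pos (by simp; omega), z]
    linear_combination (- ((-1) ^ (l + 1) / ((n + 1).choose (l + 1) : ℝ) / ((l : ℝ) + 1))) * alt
  rw [hw, hh]; ring

lemma sum_zero (r d : ℕ) :
    ∑ j ∈ Finset.range (r + d + r + 1), wC (r + d) (r + d + r) j + hC (r + d) (r + d + r) = 0 := by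
  induction d with
  | zero => have := base_sum r; rw [two_mul] at this; exact this
  | succ d ih =>
    have := step_sum (r + d) (r + d + r) (by omega)
    have e : r + (d + 1) + r = r + d + r + 1 := by omega
    rw [e, ← add_assoc r d 1]
    rw [← ih, ← this]

lemma lam0_one (l r : ℕ) (h : r ≤ l) : lam0 l r 1 = 0 := by
  obtain ⟨d, rfl⟩ := Nat.exists_eq_add_of_le h
  rw [lam0_eq]
  simp only [one_zpow, mul_one]
  have := sum_zero r d
  rw [add_comm] at this
  exact_mod_cast this

lemma lam0_deriv (l r : ℕ) (θ : ℝ) :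
    HasDerivAt (fun θ : ℝ => lam0 l r (Complex.exp (θ * Complex.I)))
      (Complex.I * ((-1) ^ l / ((l + r).choose l : ℂ) * Complex.exp (-(l * (θ * Complex.I))) *
        (1 - Complex.exp (θ * Complex.I)) ^ (l + r) - 1)) θ := by
  have hN : ((l + r).choose l : ℂ) ≠ 0 := by
    exact_mod_cast (Nat.choose_pos (by omega)).ne'
  have e : (fun θ : ℝ => lam0 l r (Complex.exp (θ * Complex.I))) = fun θ : ℝ =>
      (hC l (l + r) : ℂ) + ∑ j ∈ Finset.range (l + r + 1),
        (wC l (l + r) j : ℂ) * Complex.exp (((j : ℂ) - l) * (θ * Complex.I)) := by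
    funext t
    rw [lam0_eq]
    congr 1
    refine Finset.sum_congr rfl fun j _ => ?_
    rw [← Complex.exp_int_mul]
    push_cast; rfl
  rw [e]
  have hd : ∀ j ∈ Finset.range (l + r + 1), HasDerivAt (fun θ : ℝ => (wC l (l + r) j : ℂ) * Complex.exp (((j : ℂ) - l) * (θ * Complex.I)))
      ((wC l (l + r) j : ℂ) * (Complex.exp (((j : ℂ) - l) * (θ * Complex.I)) * (((j : ℂ) - l) * (1 * Complex.I)))) θ := by
    intro j _
    have h1 : HasDerivAt (fun θ : ℝ => (θ : ℂ)) 1 θ := Complex.ofRealCLM.hasDerivAt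
    exact (((h1.mul_const Complex.I).const_mul _).cexp).const_mul _
  refine ((HasDerivAt.fun_sum hd).const_add (hC l (l + r) : ℂ)).congr_deriv ?_
  have pt : ∀ j ∈ Finset.range (l + r + 1), (wC l (l + r) j : ℂ) * (Complex.exp (((j : ℂ) - l) * (θ * Complex.I)) * (((j : ℂ) - l) * (1 * Complex.I)))
     = Complex.I * ((-1) ^ l / ((l + r).choose l : ℂ) * Complex.exp (-(l * (θ * Complex.I)))) * ((-Complex.exp (θ * Complex.I)) ^ j * 1 ^ (l + r - j) * ((l + r).choose j : ℂ)) - if j = l then Complex.I else 0 := by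
    intro j _
    have e1 : Complex.exp (((j : ℂ) - l) * (θ * Complex.I)) = Complex.exp (-(l * (θ * Complex.I))) * Complex.exp (θ * Complex.I) ^ j := by
      rw [← Complex.exp_nat_mul, ← Complex.exp_add]; congr 1; ring
    rw [neg_pow (Complex.exp (θ * Complex.I)) j]
    by_cases hjl : j = l
    · subst hjl
      rw [wC_self, if_pos rfl]
      have : (-1 : ℂ) ^ j * (-1 : ℂ) ^ j = 1 := by
        rw [← mul_pow]; norm_num
      have e2 : Complex.exp (-(j * (θ * Complex.I))) * Complex.exp (θ * Complex.I) ^ j = 1 := by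
        rw [← e1]; simp
      simp only [one_pow, mul_one, Complex.ofReal_zero, zero_mul]
      generalize Complex.exp (-(j * (θ * Complex.I))) = A at *
      generalize Complex.exp (θ * Complex.I) = B at *
      field_simp
      linear_combination (-Complex.I) * this * (A * B ^ j) - Complex.I * e2
    · rw [if_neg hjl, e1]
      have h3 : ((j : ℂ) - l) ≠ 0 := by
        rw [sub_ne_zero]; exact_mod_cast hjl
      unfold wC
      push_cast
      field_simp
      simp only [one_pow, mul_one]
      ring
  rw [Finset.sum_congr rfl pt, Finset.sum_sub_distrib, ← Finset.mul_sum, Finset.sum_ite_eq', if_pos (by simp), ← add_pow]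
  ring

lemma one_sub_exp (θ : ℝ) : 1 - Complex.exp (θ * Complex.I) =
    -2 * Complex.I * (Real.sin (θ / 2) : ℂ) * Complex.exp ((θ / 2 : ℝ) * Complex.I) := by
  have : (θ : ℂ) * Complex.I = (θ / 2 : ℝ) * Complex.I + (θ / 2 : ℝ) * Complex.I := by
    push_cast; ring
  rw [this, Complex.exp_add, Complex.exp_mul_I, ← Complex.ofReal_cos, ← Complex.ofReal_sin]
  have h := Real.sin_sq_add_cos_sq (θ / 2)
  have h : (Real.sin (θ / 2) : ℂ) ^ 2 + (Real.cos (θ / 2) : ℂ) ^ 2 = 1 := by exact_mod_cast h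
  linear_combination (-1 : ℂ) * h + (Real.sin (θ / 2) : ℂ) ^ 2 * Complex.I_sq

lemma re_deriv (l r : ℕ) (h1 : r + 1 ≤ l) (h2 : l ≤ r + 2) (θ : ℝ) :
    (Complex.I * ((-1) ^ l / ((l + r).choose l : ℂ) * Complex.exp (-(l * (θ * Complex.I))) *
        (1 - Complex.exp (θ * Complex.I)) ^ (l + r) - 1)).re =
    - (2 ^ (2 * l - 1) / ((l + r).choose l : ℝ) * Real.sin (θ / 2) ^ (2 * l - 1) * Real.cos (θ / 2)) := by
  rw [one_sub_exp]
  have hl1 : ((-1 : ℂ)) ^ l * (-1) ^ l = 1 := by rw [← mul_pow]; norm_num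
  have hE : ∀ m : ℕ, Complex.exp ((θ / 2 : ℝ) * Complex.I) ^ m =
      Complex.exp (m * ((θ / 2 : ℝ) * Complex.I)) := fun m => (Complex.exp_nat_mul _ m).symm
  have hI : (-2 * Complex.I) ^ 2 = -4 := by
    linear_combination 4 * Complex.I_sq
  obtain h | h : l = r + 1 ∨ l = r + 2 := by omega
  · subst h
    have e : Complex.I * ((-1) ^ (r + 1) / ((r + 1 + r).choose (r + 1) : ℂ) * Complex.exp (-((r + 1 : ℕ) * (θ * Complex.I))) *
        (-2 * Complex.I * (Real.sin (θ / 2) : ℂ) * Complex.exp ((θ / 2 : ℝ) * Complex.I)) ^ (r + 1 + r) - 1)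
        = ((-(2 ^ (2 * r + 1) / ((r + 1 + r).choose (r + 1) : ℝ) * Real.sin (θ / 2) ^ (2 * r + 1)) : ℝ) : ℂ)
          * Complex.exp ((-(θ / 2) : ℝ) * Complex.I) - Complex.I := by
      have e1 : r + 1 + r = 2 * r + 1 := by omega
      rw [e1, mul_pow, mul_pow, hE, pow_succ (-2 * Complex.I), pow_mul, hI]
      have e2 : Complex.exp (-((r + 1 : ℕ) * (θ * Complex.I))) * Complex.exp ((2 * r + 1 : ℕ) * ((θ / 2 : ℝ) * Complex.I)) = Complex.exp ((-(θ / 2) : ℝ) * Complex.I) := by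
        rw [← Complex.exp_add]; congr 1; push_cast; ring
      rw [← e2]
      have e3 : (-4 : ℂ) ^ r = (-1) ^ r * 2 ^ (2 * r) := by
        rw [pow_mul, ← mul_pow]; norm_num
      have hr : ((-1 : ℂ)) ^ r * (-1) ^ r = 1 := by rw [← mul_pow]; norm_num
      rw [e3]
      push_cast
      rw [pow_succ (-1 : ℂ) r]
      generalize (-1 : ℂ) ^ r = u at *
      have hu2 : u ^ 2 = 1 := by rw [sq]; exact hr
      ring_nf
      simp only [hu2, Complex.I_sq]
      ring
    rw [e, Complex.sub_re, Complex.re_ofReal_mul, Complex.exp_ofReal_mul_I_re, Real.cos_neg]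
    have e4 : 2 * (r + 1) - 1 = 2 * r + 1 := by omega
    rw [e4]; simp
  · subst h
    have e : Complex.I * ((-1) ^ (r + 2) / ((r + 2 + r).choose (r + 2) : ℂ) * Complex.exp (-((r + 2 : ℕ) * (θ * Complex.I))) *
        (-2 * Complex.I * (Real.sin (θ / 2) : ℂ) * Complex.exp ((θ / 2 : ℝ) * Complex.I)) ^ (r + 2 + r) - 1)
        = Complex.I * (((-(2 ^ (2 * r + 2) / ((r + 2 + r).choose (r + 2) : ℝ) * Real.sin (θ / 2) ^ (2 * r + 2)) : ℝ) : ℂ)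
          * Complex.exp ((-θ : ℝ) * Complex.I)) - Complex.I := by
      have e1 : r + 2 + r = 2 * r + 2 := by omega
      have e1' : 2 * r + 2 = 2 * (r + 1) := by omega
      rw [e1, mul_pow, mul_pow, hE, e1', pow_mul (-2 * Complex.I), hI]
      have e2 : Complex.exp (-((r + 2 : ℕ) * (θ * Complex.I))) * Complex.exp ((2 * (r + 1) : ℕ) * ((θ / 2 : ℝ) * Complex.I)) = Complex.exp ((-θ : ℝ) * Complex.I) := by
        rw [← Complex.exp_add]; congr 1; push_cast; ring
      rw [← e2]
      have e3 : (-4 : ℂ) ^ (r + 1) = (-1) ^ (r + 1) * 2 ^ (2 * (r + 1)) := by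
        rw [pow_mul, ← mul_pow]; norm_num
      have hr : ((-1 : ℂ)) ^ r * (-1) ^ r = 1 := by rw [← mul_pow]; norm_num
      rw [e3]
      push_cast
      rw [pow_add (-1 : ℂ) r, pow_succ (-1 : ℂ) r]
      generalize (-1 : ℂ) ^ r = u at *
      have hu2 : u ^ 2 = 1 := by rw [sq]; exact hr
      ring_nf
      simp only [hu2]
      ring
    rw [e, Complex.sub_re, Complex.I_mul_re, Complex.im_ofReal_mul, Complex.exp_ofReal_mul_I_im, Real.sin_neg]
    have e4 : 2 * (r + 2) - 1 = 2 * r + 3 := by omega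
    have e5 : Real.sin θ = 2 * Real.sin (θ / 2) * Real.cos (θ / 2) := by
      rw [← Real.sin_two_mul]; congr 1; ring
    rw [e4, e5, Complex.I_re]; ring

lemma lam0_re (l r : ℕ) (h1 : r + 1 ≤ l) (h2 : l ≤ r + 2) (θ : ℝ) :
    (lam0 l r (Complex.exp (θ * Complex.I))).re =
      - (2 ^ (2 * l - 1) / ((l + r).choose l : ℝ) / l * Real.sin (θ / 2) ^ (2 * l)) := by
  have hl : (l : ℝ) ≠ 0 := by
    have : l ≠ 0 := by omega
    exact_mod_cast this
  set K := (2 : ℝ) ^ (2 * l - 1) / ((l + r).choose l : ℝ) with hK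
  let g : ℝ → ℝ := fun θ => (lam0 l r (Complex.exp (θ * Complex.I))).re +
    K / l * Real.sin (θ / 2) ^ (2 * l)
  have hg : ∀ t, HasDerivAt g 0 t := by
    intro t
    have a := (Complex.reCLM.hasFDerivAt.comp_hasDerivAt t (lam0_deriv l r t))
    have b : HasDerivAt (fun θ : ℝ => Real.sin (θ / 2)) (Real.cos (t / 2) * (1 / 2)) t :=
      ((hasDerivAt_id t).div_const 2).sin
    have c := a.add ((b.pow (2 * l)).const_mul (K / l))
    refine c.congr_deriv ?_
    rw [Complex.reCLM_apply, re_deriv l r h1 h2]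
    push_cast
    field_simp
    ring
  have hc := is_const_of_deriv_eq_zero (fun t => (hg t).differentiableAt) (fun t => (hg t).deriv) θ 0
  have g0 : g 0 = 0 := by
    have : 2 * l ≠ 0 := by omega
    simp [g, lam0_one l r (by omega), this]
  rw [g0] at hc
  simp only [g] at hc
  linarith

lemma lam0_im_bound (l r : ℕ) (h1 : r + 1 ≤ l) (θ : ℝ) (hθ : |θ| ≤ 1) :
    |(lam0 l r (Complex.exp (θ * Complex.I))).im + θ| ≤ θ ^ 2 := by
  let g : ℝ → ℂ := fun t => lam0 l r (Complex.exp (t * Complex.I)) + Complex.I * t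
  have hg : ∀ t : ℝ, HasDerivAt g (Complex.I * ((-1) ^ l / ((l + r).choose l : ℂ) * Complex.exp (-(l * (t * Complex.I))) *
        (1 - Complex.exp (t * Complex.I)) ^ (l + r) - 1) + Complex.I * 1) t := by
    intro t
    have h1 : HasDerivAt (fun θ : ℝ => (θ : ℂ)) 1 t := Complex.ofRealCLM.hasDerivAt
    exact (lam0_deriv l r t).add (h1.const_mul _)
  have hN : (1 : ℝ) ≤ ((l + r).choose l : ℝ) := by
    exact_mod_cast (Nat.choose_pos (by omega))
  have bd : ∀ t ∈ Set.Icc (-|θ|) |θ|, ‖(Complex.I * ((-1) ^ l / ((l + r).choose l : ℂ) * Complex.exp (-(l * (t * Complex.I))) *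
        (1 - Complex.exp (t * Complex.I)) ^ (l + r) - 1) + Complex.I * 1)‖ ≤ |θ| := by
    intro t ht
    have htt : |t| ≤ |θ| := abs_le.2 ht
    have e : (Complex.I * ((-1) ^ l / ((l + r).choose l : ℂ) * Complex.exp (-(l * (t * Complex.I))) *
        (1 - Complex.exp (t * Complex.I)) ^ (l + r) - 1) + Complex.I * 1) = Complex.I * ((-1) ^ l / ((l + r).choose l : ℂ) * Complex.exp ((-(l * t) : ℝ) * Complex.I) *
        (1 - Complex.exp (t * Complex.I)) ^ (l + r)) := by
      have : (-(l * (t * Complex.I))) = ((-(l * t) : ℝ) : ℂ) * Complex.I := by push_cast; ring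
      rw [this]; ring
    have n1 : ‖1 - Complex.exp (t * Complex.I)‖ ≤ |θ| := by
      rw [one_sub_exp]
      simp only [norm_mul, Complex.norm_exp_ofReal_mul_I, Complex.norm_I, Complex.norm_real, norm_neg, Real.norm_eq_abs]
      have := Real.abs_sin_le_abs (x := t / 2)
      rw [abs_div] at this
      norm_num at this ⊢
      linarith
    rw [e]
    simp only [norm_mul, norm_div, norm_pow, norm_neg, norm_one, one_pow, Complex.norm_I, Complex.norm_exp_ofReal_mul_I, Complex.norm_natCast, one_mul, mul_one]
    calc 1 / ((l + r).choose l : ℝ) * ‖1 - Complex.exp (t * Complex.I)‖ ^ (l + r)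
        ≤ 1 * |θ| ^ (l + r) := by
          gcongr
          rw [div_le_one (by linarith)]; exact hN
      _ ≤ |θ| := by
        rw [one_mul]
        exact pow_le_of_le_one (abs_nonneg _) hθ (by omega)
  have mv := (convex_Icc (-|θ|) |θ|).norm_image_sub_le_of_norm_hasDerivWithin_le
    (f := g) (fun t _ => (hg t).hasDerivWithinAt) bd (x := 0) (y := θ)
    (by simp) (abs_le.1 le_rfl)
  have g0 : g 0 = 0 := by
    simp [g, lam0_one l r (by omega)]
  rw [g0, sub_zero, sub_zero, Real.norm_eq_abs, ← sq, sq_abs] at mv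
  have := (Complex.abs_im_le_norm (g θ)).trans mv
  simpa [g] using this

/-- Asymptotics of the stable advection symbol near the origin:
`x₀ = -C₁·y₀^{2l} + O(y₀^{2l+1})` as `θ → 0`. -/
theorem lam0_asymptotics (l r : ℕ) (h1 : r + 1 ≤ l) (h2 : l ≤ r + 2) :
    ∃ C₁ > (0 : ℝ), ∃ C > (0 : ℝ), ∃ δ > (0 : ℝ), ∀ θ : ℝ, 0 < |θ| → |θ| < δ →
      |(lam0 l r (Complex.exp (θ * Complex.I))).re +
          C₁ * (lam0 l r (Complex.exp (θ * Complex.I))).im ^ (2 * l)| ≤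
        C * |(lam0 l r (Complex.exp (θ * Complex.I))).im| ^ (2 * l + 1) := by
  have hl0 : 0 < l := by omega
  have hl : (0 : ℝ) < l := by
    have : 0 < l := by omega
    exact_mod_cast this
  have hN : (0 : ℝ) < ((l + r).choose l : ℝ) := by
    exact_mod_cast (Nat.choose_pos (by omega))
  set K := (2 : ℝ) ^ (2 * l - 1) / ((l + r).choose l : ℝ) / l with hK
  have hKpos : 0 < K := by positivity
  refine ⟨K / 2 ^ (2 * l), by positivity,
    K / 2 ^ (2 * l) * (2 * (2 * l : ℕ) * 2 ^ (2 * l - 1) * 2 ^ (2 * l + 1)), by positivity, 1 / 2, by norm_num, ?_⟩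
  intro θ h0 hθ
  rw [lam0_re l r h1 h2]
  have hy := lam0_im_bound l r h1 θ (by linarith)
  generalize (lam0 l r (Complex.exp (θ * Complex.I))).im = y at *
  set u := 2 * Real.sin (θ / 2) with hu
  have hu1 : |u| ≤ |θ| := by
    have := Real.abs_sin_le_abs (x := θ / 2)
    rw [abs_div] at this
    rw [hu, abs_mul]
    norm_num at this ⊢
    linarith
  have hu2 : |u - θ| ≤ θ ^ 2 := by
    have b := Real.sin_bound (x := θ / 2) (by rw [abs_div]; norm_num; linarith)
    have h4 : |θ / 2| ^ 5 ≤ θ ^ 4 / 16 := by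
      have h5 : |θ / 2| ^ 4 = θ ^ 4 / 16 := by
        rw [(by norm_num : 4 = 2 * 2), pow_mul, sq_abs]; ring
      rw [← h5]
      exact pow_le_pow_of_le_one (abs_nonneg _) (by rw [abs_div]; norm_num; linarith) (by norm_num)
    obtain ⟨t1, t2⟩ := abs_lt.1 hθ
    obtain ⟨b1, b2⟩ := abs_le.1 b
    have q2 : 0 ≤ θ ^ 2 := sq_nonneg θ
    have q3 : |θ ^ 3| ≤ θ ^ 2 := by
      rw [pow_succ, abs_mul, abs_of_nonneg q2]; nlinarith
    have q4 : θ ^ 4 ≤ θ ^ 2 := by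
      have q1 : θ ^ 2 ≤ 1 := by nlinarith
      have : θ ^ 4 = θ ^ 2 * θ ^ 2 := by ring
      rw [this]; nlinarith
    obtain ⟨q5, q6⟩ := abs_le.1 q3
    rw [abs_le]
    constructor <;> nlinarith
  have hθ2 : θ ^ 2 ≤ |θ| / 2 := by
    rw [← sq_abs]; nlinarith
  have hy1 : |θ| ≤ 2 * |y| := by
    have := abs_sub_abs_le_abs_sub θ (-y)
    rw [abs_neg, sub_neg_eq_add, add_comm θ y] at this
    linarith
  have hy2 : |y| ≤ 2 * |θ| := by
    have := abs_sub_abs_le_abs_sub (-y) θ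
    rw [abs_neg, ← neg_add', abs_neg] at this
    linarith
  have hd : |(-y) - u| ≤ 2 * θ ^ 2 := by
    have : (-y) - u = -(y + θ) - (u - θ) := by ring
    rw [this]
    have t := norm_sub_le (-(y + θ)) (u - θ)
    rw [norm_neg] at t
    simp only [Real.norm_eq_abs] at t
    linarith
  have e : -(K * Real.sin (θ / 2) ^ (2 * l)) + K / 2 ^ (2 * l) * y ^ (2 * l) =
      K / 2 ^ (2 * l) * ((-y) ^ (2 * l) - u ^ (2 * l)) := by
    rw [hu, mul_pow, (even_two_mul l).neg_pow]
    field_simp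
    ring
  rw [e, abs_mul, abs_of_pos (by positivity : 0 < K / 2 ^ (2 * l)), mul_assoc]
  gcongr
  calc |(-y) ^ (2 * l) - u ^ (2 * l)| ≤ |(-y) - u| * (2 * l : ℕ) * max |(-y)| |u| ^ (2 * l - 1) :=
        abs_pow_sub_pow_le _ _ _
    _ ≤ (2 * θ ^ 2) * (2 * l : ℕ) * (2 * |θ|) ^ (2 * l - 1) := by
        gcongr
        rw [abs_neg]
        exact max_le hy2 (by linarith)
    _ = 2 * (2 * l : ℕ) * 2 ^ (2 * l - 1) * |θ| ^ (2 * l + 1) := by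
        have : 2 * l + 1 = 2 + (2 * l - 1) := by omega
        rw [this, pow_add, mul_pow, sq_abs]; ring
    _ ≤ 2 * (2 * l : ℕ) * 2 ^ (2 * l - 1) * (2 * |y|) ^ (2 * l + 1) := by
        gcongr
    _ = _ := by rw [mul_pow]; ring
end
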